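/- Fix $\varepsilon \in (0, 5/4)$. For $X \geq 1$, let $N(X)$ denote the number of squarefree integers $d$ with $1 \leq d \leq X$ for which there exist coprime integers $(p,q)$ with $q \geq 1$ and a rational number $y \neq 0$ such that $d y^2 = (p/q)^3 - (p/q)$ and $\max\{|p|, q\} \leq d^{5/4 - \varepsilon}$. Then $N(X)/X \to 0$ as $X \to \infty$. -/

import Mathlib

theorem pairmod (n : ℕ) (hn : Squarefree n) (α β a1 a2 a1' a2' b1 b2 : ℤ)
    (hα : IsCoprime (n : ℤ) α) (hb1 : IsCoprime (n : ℤ) b1) (hb2 : IsCoprime (n : ℤ) b2)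
    (ha : (n : ℤ) ∣ α * a1 ^ 2 + β * a2 ^ 2) (ha' : (n : ℤ) ∣ α * a1' ^ 2 + β * a2' ^ 2)
    (hb : (n : ℤ) ∣ α * b1 ^ 2 + β * b2 ^ 2)
    (hg : Int.gcd n (a1 * b2 - a2 * b1) = Int.gcd n (a1' * b2 - a2' * b1)) :
    (n : ℤ) ∣ a1 * a2' - a2 * a1' := by
  have hn0 : 0 < n := Nat.pos_of_ne_zero hn.ne_zero
  have key : ∀ a1 a2 : ℤ, (n : ℤ) ∣ α * a1 ^ 2 + β * a2 ^ 2 →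
      ((n / Int.gcd n (a1 * b2 - a2 * b1) : ℕ) : ℤ) ∣ a1 * b2 + a2 * b1 := by
    intro a1 a2 ha
    have h1 : (n : ℤ) ∣ (a1 * b2 - a2 * b1) * (a1 * b2 + a2 * b1) := by
      apply hα.dvd_of_dvd_mul_left
      have : α * ((a1 * b2 - a2 * b1) * (a1 * b2 + a2 * b1)) =
        b2 ^ 2 * (α * a1 ^ 2 + β * a2 ^ 2) - a2 ^ 2 * (α * b1 ^ 2 + β * b2 ^ 2) := by ring
      rw [this]
      exact dvd_sub (ha.mul_left _) (hb.mul_left _)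
    set A := a1 * b2 - a2 * b1
    set B := a1 * b2 + a2 * b1
    have h2 := Int.natAbs_dvd_natAbs.2 h1
    rw [Int.natAbs_mul, Int.natAbs_natCast] at h2
    rw [← Int.natAbs_dvd_natAbs, Int.natAbs_natCast]
    have h3 : Int.gcd n A = Nat.gcd n A.natAbs := rfl
    rw [h3]
    have hgpos : 0 < Nat.gcd n A.natAbs := Nat.gcd_pos_of_pos_left _ hn0
    have hc := Nat.coprime_div_gcd_div_gcd hgpos
    apply hc.dvd_of_dvd_mul_left
    apply Nat.dvd_of_mul_dvd_mul_left hgpos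
    rw [← mul_assoc, Nat.mul_div_cancel' (Nat.gcd_dvd_left _ _),
      Nat.mul_div_cancel' (Nat.gcd_dvd_right _ _)]
    exact h2
  have k1 := key a1 a2 ha
  have k2 := key a1' a2' ha'
  rw [← hg] at k2
  have g1 : ((Int.gcd n (a1 * b2 - a2 * b1) : ℕ) : ℤ) ∣ a1 * b2 - a2 * b1 := Int.gcd_dvd_right _ _
  have g2 : ((Int.gcd n (a1 * b2 - a2 * b1) : ℕ) : ℤ) ∣ a1' * b2 - a2' * b1 := by
    rw [hg]; exact Int.gcd_dvd_right _ _
  have hgn : Int.gcd n (a1 * b2 - a2 * b1) ∣ n := by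
    have := Int.gcd_dvd_left (n : ℤ) (a1 * b2 - a2 * b1)
    exact_mod_cast this
  generalize Int.gcd n (a1 * b2 - a2 * b1) = g at *
  obtain ⟨h, rfl⟩ := hgn
  have hg0 : 0 < g := Nat.pos_of_mul_pos_right hn0
  rw [Nat.mul_div_cancel_left _ hg0] at k1 k2
  have hcop : IsCoprime (g : ℤ) (h : ℤ) :=
    Nat.isCoprime_iff_coprime.2 (Nat.coprime_of_squarefree_mul hn)
  have hb12 : IsCoprime ((g * h : ℕ) : ℤ) (b1 * b2) := hb1.mul_right hb2
  apply hb12.dvd_of_dvd_mul_left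
  push_cast
  apply hcop.mul_dvd
  · have : b1 * b2 * (a1 * a2' - a2 * a1') =
      a2' * b1 * (a1 * b2 - a2 * b1) - a2 * b1 * (a1' * b2 - a2' * b1) := by ring
    rw [this]
    exact dvd_sub (g1.mul_left _) (g2.mul_left _)
  · have : b1 * b2 * (a1 * a2' - a2 * a1') =
      a2' * b1 * (a1 * b2 + a2 * b1) - a2 * b1 * (a1' * b2 + a2' * b1) := by ring
    rw [this]
    exact dvd_sub (k1.mul_left _) (k2.mul_left _)

structure Sol (e1 e2 e3 n1 n2 n3 : ℕ) (R : ℝ) (a : ℕ × ℕ × ℕ) : Prop where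
  p1 : 0 < a.1
  p2 : 0 < a.2.1
  p3 : 0 < a.2.2
  eq : e1 * n1 * a.1 ^ 2 + e2 * n2 * a.2.1 ^ 2 = e3 * n3 * a.2.2 ^ 2
  le : ((e3 * n3 * a.2.2 ^ 2 : ℕ) : ℝ) ≤ R ^ 2
  c12 : Nat.Coprime n1 (e2 * n2 * a.2.1)
  c13 : Nat.Coprime n1 (e3 * n3 * a.2.2)
  c21 : Nat.Coprime n2 (e1 * n1 * a.1)
  c23 : Nat.Coprime n2 (e3 * n3 * a.2.2)
  c31 : Nat.Coprime n3 (e1 * n1 * a.1)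
  c32 : Nat.Coprime n3 (e2 * n2 * a.2.1)
  c : Nat.Coprime a.1 a.2.1

def cls (n : ℕ) (a1 a2 b1 b2 : ℕ) : ℕ := Int.gcd n ((a1 : ℤ) * b2 - a2 * b1)

theorem cls_mem (n a1 a2 b1 b2 : ℕ) (hn : n ≠ 0) : cls n a1 a2 b1 b2 ∈ n.divisors := by
  rw [Nat.mem_divisors]
  refine ⟨?_, hn⟩
  exact Int.natCast_dvd_natCast.1 (Int.gcd_dvd_left (n : ℤ) ((a1 : ℤ) * b2 - a2 * b1))

def detZ (a b c : ℕ × ℕ × ℕ) : ℤ :=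
  (a.1 : ℤ) * (b.2.1 * c.2.2 - b.2.2 * c.2.1) - a.2.1 * (b.1 * c.2.2 - b.2.2 * c.1)
    + a.2.2 * (b.1 * c.2.1 - b.2.1 * c.1)

section
variable {e1 e2 e3 n1 n2 n3 : ℕ} {R : ℝ}

theorem minor12 (hn : Squarefree n3) {a a' b : ℕ × ℕ × ℕ}
    (ha : Sol e1 e2 e3 n1 n2 n3 R a) (ha' : Sol e1 e2 e3 n1 n2 n3 R a')
    (hb : Sol e1 e2 e3 n1 n2 n3 R b)
    (hg : cls n3 a.1 a.2.1 b.1 b.2.1 = cls n3 a'.1 a'.2.1 b.1 b.2.1) :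
    (n3 : ℤ) ∣ a.1 * a'.2.1 - a.2.1 * a'.1 := by
  have key : ∀ a : ℕ × ℕ × ℕ, Sol e1 e2 e3 n1 n2 n3 R a →
      (n3 : ℤ) ∣ ((e1 * n1 : ℕ) : ℤ) * (a.1 : ℤ) ^ 2 + ((e2 * n2 : ℕ) : ℤ) * (a.2.1 : ℤ) ^ 2 := by
    intro a ha
    have := ha.eq
    have h2 : ((e1 * n1 : ℕ) : ℤ) * (a.1 : ℤ) ^ 2 + ((e2 * n2 : ℕ) : ℤ) * (a.2.1 : ℤ) ^ 2
      = n3 * (e3 * a.2.2 ^ 2) := by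
      have : ((e1 * n1 * a.1 ^ 2 + e2 * n2 * a.2.1 ^ 2 : ℕ) : ℤ) = ((e3 * n3 * a.2.2 ^ 2 : ℕ) : ℤ) := by
        rw [this]
      push_cast at this ⊢
      linarith
    rw [h2]; exact dvd_mul_right _ _
  refine pairmod n3 hn _ _ _ _ _ _ _ _ ?_ ?_ ?_ (key a ha) (key a' ha') (key b hb) hg
  · exact Nat.isCoprime_iff_coprime.2 (Nat.Coprime.coprime_mul_right_right hb.c31)
  · exact Nat.isCoprime_iff_coprime.2 (Nat.Coprime.coprime_mul_left_right hb.c31)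
  · exact Nat.isCoprime_iff_coprime.2 (Nat.Coprime.coprime_mul_left_right hb.c32)

theorem minor13 (hn : Squarefree n2) {a a' b : ℕ × ℕ × ℕ}
    (ha : Sol e1 e2 e3 n1 n2 n3 R a) (ha' : Sol e1 e2 e3 n1 n2 n3 R a')
    (hb : Sol e1 e2 e3 n1 n2 n3 R b)
    (hg : cls n2 a.1 a.2.2 b.1 b.2.2 = cls n2 a'.1 a'.2.2 b.1 b.2.2) :
    (n2 : ℤ) ∣ a.1 * a'.2.2 - a.2.2 * a'.1 := by
  have key : ∀ a : ℕ × ℕ × ℕ, Sol e1 e2 e3 n1 n2 n3 R a →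
      (n2 : ℤ) ∣ ((e1 * n1 : ℕ) : ℤ) * (a.1 : ℤ) ^ 2 + (-((e3 * n3 : ℕ) : ℤ)) * (a.2.2 : ℤ) ^ 2 := by
    intro a ha
    have := ha.eq
    have h2 : ((e1 * n1 : ℕ) : ℤ) * (a.1 : ℤ) ^ 2 + (-((e3 * n3 : ℕ) : ℤ)) * (a.2.2 : ℤ) ^ 2
      = n2 * (- e2 * a.2.1 ^ 2) := by
      have : ((e1 * n1 * a.1 ^ 2 + e2 * n2 * a.2.1 ^ 2 : ℕ) : ℤ) = ((e3 * n3 * a.2.2 ^ 2 : ℕ) : ℤ) := by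
        rw [this]
      push_cast at this ⊢
      linarith
    rw [h2]; exact dvd_mul_right _ _
  refine pairmod n2 hn _ _ _ _ _ _ _ _ ?_ ?_ ?_ (key a ha) (key a' ha') (key b hb) hg
  · exact Nat.isCoprime_iff_coprime.2 (Nat.Coprime.coprime_mul_right_right hb.c21)
  · exact Nat.isCoprime_iff_coprime.2 (Nat.Coprime.coprime_mul_left_right hb.c21)
  · exact Nat.isCoprime_iff_coprime.2 (Nat.Coprime.coprime_mul_left_right hb.c23)

theorem minor23 (hn : Squarefree n1) {a a' b : ℕ × ℕ × ℕ}
    (ha : Sol e1 e2 e3 n1 n2 n3 R a) (ha' : Sol e1 e2 e3 n1 n2 n3 R a')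
    (hb : Sol e1 e2 e3 n1 n2 n3 R b)
    (hg : cls n1 a.2.1 a.2.2 b.2.1 b.2.2 = cls n1 a'.2.1 a'.2.2 b.2.1 b.2.2) :
    (n1 : ℤ) ∣ a.2.1 * a'.2.2 - a.2.2 * a'.2.1 := by
  have key : ∀ a : ℕ × ℕ × ℕ, Sol e1 e2 e3 n1 n2 n3 R a →
      (n1 : ℤ) ∣ ((e2 * n2 : ℕ) : ℤ) * (a.2.1 : ℤ) ^ 2 + (-((e3 * n3 : ℕ) : ℤ)) * (a.2.2 : ℤ) ^ 2 := by
    intro a ha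
    have := ha.eq
    have h2 : ((e2 * n2 : ℕ) : ℤ) * (a.2.1 : ℤ) ^ 2 + (-((e3 * n3 : ℕ) : ℤ)) * (a.2.2 : ℤ) ^ 2
      = n1 * (- e1 * a.1 ^ 2) := by
      have : ((e1 * n1 * a.1 ^ 2 + e2 * n2 * a.2.1 ^ 2 : ℕ) : ℤ) = ((e3 * n3 * a.2.2 ^ 2 : ℕ) : ℤ) := by
        rw [this]
      push_cast at this ⊢
      linarith
    rw [h2]; exact dvd_mul_right _ _
  refine pairmod n1 hn _ _ _ _ _ _ _ _ ?_ ?_ ?_ (key a ha) (key a' ha') (key b hb) hg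
  · exact Nat.isCoprime_iff_coprime.2 (Nat.Coprime.coprime_mul_right_right hb.c12)
  · exact Nat.isCoprime_iff_coprime.2 (Nat.Coprime.coprime_mul_left_right hb.c12)
  · exact Nat.isCoprime_iff_coprime.2 (Nat.Coprime.coprime_mul_left_right hb.c13)

theorem det_dvd {a b c : ℕ × ℕ × ℕ} (hs : Sol e1 e2 e3 n1 n2 n3 R a)
    (h1 : (n1 : ℤ) ∣ b.2.1 * c.2.2 - b.2.2 * c.2.1) (h1' : (n1 : ℤ) ∣ a.2.1 * b.2.2 - a.2.2 * b.2.1)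
    (h1'' : (n1 : ℤ) ∣ a.2.1 * c.2.2 - a.2.2 * c.2.1)
    (h2 : (n2 : ℤ) ∣ b.1 * c.2.2 - b.2.2 * c.1) (h2' : (n2 : ℤ) ∣ a.1 * b.2.2 - a.2.2 * b.1)
    (h2'' : (n2 : ℤ) ∣ a.1 * c.2.2 - a.2.2 * c.1)
    (h3 : (n3 : ℤ) ∣ b.1 * c.2.1 - b.2.1 * c.1) (h3' : (n3 : ℤ) ∣ a.1 * b.2.1 - a.2.1 * b.1)
    (h3'' : (n3 : ℤ) ∣ a.1 * c.2.1 - a.2.1 * c.1) :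
    ((n1 * n2 * n3 : ℕ) : ℤ) ∣ detZ a b c := by
  have d1 : (n1 : ℤ) ∣ detZ a b c := by
    have : detZ a b c = a.1 * (b.2.1 * c.2.2 - b.2.2 * c.2.1)
      - b.1 * (a.2.1 * c.2.2 - a.2.2 * c.2.1) + c.1 * (a.2.1 * b.2.2 - a.2.2 * b.2.1) := by
      unfold detZ; ring
    rw [this]
    exact dvd_add (dvd_sub (h1.mul_left _) (h1''.mul_left _)) (h1'.mul_left _)
  have d2 : (n2 : ℤ) ∣ detZ a b c := by
    have : detZ a b c = -(a.2.1 * (b.1 * c.2.2 - b.2.2 * c.1)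
      - b.2.1 * (a.1 * c.2.2 - a.2.2 * c.1) + c.2.1 * (a.1 * b.2.2 - a.2.2 * b.1)) := by
      unfold detZ; ring
    rw [this]
    exact (dvd_add (dvd_sub (h2.mul_left _) (h2''.mul_left _)) (h2'.mul_left _)).neg_right
  have d3 : (n3 : ℤ) ∣ detZ a b c := by
    have : detZ a b c = a.2.2 * (b.1 * c.2.1 - b.2.1 * c.1)
      - b.2.2 * (a.1 * c.2.1 - a.2.1 * c.1) + c.2.2 * (a.1 * b.2.1 - a.2.1 * b.1) := by
      unfold detZ; ring
    rw [this]
    exact dvd_add (dvd_sub (h3.mul_left _) (h3''.mul_left _)) (h3'.mul_left _)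
  have c12 : IsCoprime (n1 : ℤ) n2 := Nat.isCoprime_iff_coprime.2
    (Nat.Coprime.coprime_mul_left_right (Nat.Coprime.coprime_mul_right_right hs.c12))
  have c13 : IsCoprime (n1 : ℤ) n3 := Nat.isCoprime_iff_coprime.2
    (Nat.Coprime.coprime_mul_left_right (Nat.Coprime.coprime_mul_right_right hs.c13))
  have c23 : IsCoprime (n2 : ℤ) n3 := Nat.isCoprime_iff_coprime.2
    (Nat.Coprime.coprime_mul_left_right (Nat.Coprime.coprime_mul_right_right hs.c23))
  push_cast
  exact (c13.mul_left c23).mul_dvd (c12.mul_dvd d1 d2) d3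

noncomputable def tval (c1 c2 c3 : ℝ) (a : ℕ × ℕ × ℕ) : ℝ :=
  √c1 * a.1 / (√c3 * a.2.2 + √c2 * a.2.1)

noncomputable def kval (c2 c3 : ℝ) (a : ℕ × ℕ × ℕ) : ℝ :=
  (√c3 * a.2.2 + √c2 * a.2.1) / 2

theorem param {c1 c2 c3 : ℝ} (h1 : 0 < c1) (h2 : 0 < c2) (h3 : 0 < c3) {R : ℝ} (hR : 0 < R)
    {a : ℕ × ℕ × ℕ} (p1 : 0 < a.1) (p2 : 0 < a.2.1) (p3 : 0 < a.2.2)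
    (eq : c1 * a.1 ^ 2 + c2 * a.2.1 ^ 2 = c3 * a.2.2 ^ 2) (le : c3 * (a.2.2 : ℝ) ^ 2 ≤ R ^ 2) :
    0 < kval c2 c3 a ∧ kval c2 c3 a ≤ R ∧ 0 ≤ tval c1 c2 c3 a ∧ tval c1 c2 c3 a ≤ 1 ∧
    √c1 * a.1 = kval c2 c3 a * (2 * tval c1 c2 c3 a) ∧
    √c2 * a.2.1 = kval c2 c3 a * (1 - tval c1 c2 c3 a ^ 2) ∧
    √c3 * a.2.2 = kval c2 c3 a * (1 + tval c1 c2 c3 a ^ 2) := by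
  unfold kval tval
  have p1' : (0 : ℝ) < a.1 := by exact_mod_cast p1
  have p2' : (0 : ℝ) < a.2.1 := by exact_mod_cast p2
  have p3' : (0 : ℝ) < a.2.2 := by exact_mod_cast p3
  have q1 : 0 < √c1 * a.1 := by positivity
  have q2 : 0 < √c2 * a.2.1 := by positivity
  have q3 : 0 < √c3 * a.2.2 := by positivity
  have s1 : (√c1 * a.1) ^ 2 = c1 * a.1 ^ 2 := by rw [mul_pow, Real.sq_sqrt h1.le]
  have s2 : (√c2 * a.2.1) ^ 2 = c2 * a.2.1 ^ 2 := by rw [mul_pow, Real.sq_sqrt h2.le]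
  have s3 : (√c3 * a.2.2) ^ 2 = c3 * a.2.2 ^ 2 := by rw [mul_pow, Real.sq_sqrt h3.le]
  rw [← s1, ← s2, ← s3] at eq
  rw [← s3] at le
  generalize √c1 * (a.1 : ℝ) = x at *
  generalize √c2 * (a.2.1 : ℝ) = y at *
  generalize √c3 * (a.2.2 : ℝ) = z at *
  have hzR : z ≤ R := by nlinarith
  have hyz : y ≤ z := by nlinarith
  have hxz : x ≤ z := by nlinarith
  have hpos : 0 < z + y := by positivity
  refine ⟨by positivity, by linarith, by positivity, ?_, ?_, ?_, ?_⟩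
  · rw [div_le_one hpos]; linarith
  · field_simp
  · field_simp; nlinarith
  · field_simp; nlinarith

theorem three_pts {c1 c2 c3 : ℝ} (h1 : 0 < c1) (h2 : 0 < c2) (h3 : 0 < c3) {R δ N : ℝ}
    {a b c : ℕ × ℕ × ℕ} {ka ta kb tb kc tc : ℝ}
    (a1 : √c1 * a.1 = ka * (2 * ta)) (a2 : √c2 * a.2.1 = ka * (1 - ta ^ 2))
    (a3 : √c3 * a.2.2 = ka * (1 + ta ^ 2))
    (b1 : √c1 * b.1 = kb * (2 * tb)) (b2 : √c2 * b.2.1 = kb * (1 - tb ^ 2))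
    (b3 : √c3 * b.2.2 = kb * (1 + tb ^ 2))
    (cc1 : √c1 * c.1 = kc * (2 * tc)) (cc2 : √c2 * c.2.1 = kc * (1 - tc ^ 2))
    (cc3 : √c3 * c.2.2 = kc * (1 + tc ^ 2))
    (hka : 0 < ka) (hkb : 0 < kb) (hkc : 0 < kc) (hka' : ka ≤ R) (hkb' : kb ≤ R) (hkc' : kc ≤ R)
    (hab : |ta - tb| ≤ δ) (hac : |ta - tc| ≤ δ) (hbc : |tb - tc| ≤ δ)
    (hN : 0 < N) (hNc : N ≤ c1 * c2 * c3) (hδ : 2 * R * δ ≤ √N)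
    (hdet : detZ a b c = 0 ∨ N ≤ |(detZ a b c : ℝ)|) :
    ta = tb ∨ ta = tc ∨ tb = tc := by
  have id1 : √c1 * √c2 * √c3 * (detZ a b c : ℝ) =
      4 * (ka * kb * kc) * ((ta - tb) * (ta - tc) * (tb - tc)) := by
    have : √c1 * √c2 * √c3 * (detZ a b c : ℝ) =
      (√c1 * a.1) * ((√c2 * b.2.1) * (√c3 * c.2.2) - (√c3 * b.2.2) * (√c2 * c.2.1))
      - (√c2 * a.2.1) * ((√c1 * b.1) * (√c3 * c.2.2) - (√c3 * b.2.2) * (√c1 * c.1))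
      + (√c3 * a.2.2) * ((√c1 * b.1) * (√c2 * c.2.1) - (√c2 * b.2.1) * (√c1 * c.1)) := by
      unfold detZ; push_cast; ring
    rw [this, a1, a2, a3, b1, b2, b3, cc1, cc2, cc3]
    ring
  have hz : (detZ a b c : ℝ) = 0 → ta = tb ∨ ta = tc ∨ tb = tc := by
    intro h0
    rw [h0, mul_zero] at id1
    have hk : 4 * (ka * kb * kc) ≠ 0 := by positivity
    have := (mul_eq_zero.1 id1.symm).resolve_left hk
    rcases mul_eq_zero.1 this with h | h
    · rcases mul_eq_zero.1 h with h | h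
      · left; linarith
      · right; left; linarith
    · right; right; linarith
  rcases hdet with h | h
  · apply hz; rw [h]; simp
  · exfalso
    have hδ0 : 0 ≤ δ := (abs_nonneg _).trans hab
    have hR : 0 < R := hka.trans_le hka'
    have e1 : |√c1 * √c2 * √c3 * (detZ a b c : ℝ)| = √(c1 * c2 * c3) * |(detZ a b c : ℝ)| := by
      rw [Real.sqrt_mul (by positivity), Real.sqrt_mul (by positivity), abs_mul,
        abs_of_nonneg (by positivity : 0 ≤ √c1 * √c2 * √c3)]
    have l1 : √N * N ≤ √(c1 * c2 * c3) * |(detZ a b c : ℝ)| := by gcongr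
    have e2 : |4 * (ka * kb * kc) * ((ta - tb) * (ta - tc) * (tb - tc))| =
        4 * (ka * kb * kc) * (|ta - tb| * |ta - tc| * |tb - tc|) := by
      rw [abs_mul, abs_of_pos (by positivity : 0 < 4 * (ka * kb * kc)), abs_mul, abs_mul]
    have l2 : 4 * (ka * kb * kc) * (|ta - tb| * |ta - tc| * |tb - tc|) ≤
        4 * (R * R * R) * (δ * δ * δ) := by gcongr
    rw [← e1, id1, e2] at l1
    have hs : √N * √N = N := Real.mul_self_sqrt hN.le
    have hs0 : 0 < √N := Real.sqrt_pos.2 hN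
    have l3 : (2 * R * δ) * (2 * R * δ) * (2 * R * δ) ≤ √N * √N * √N := by gcongr
    nlinarith [mul_pos hs0 hN]

theorem conic_count (he1 : 0 < e1) (he2 : 0 < e2) (he3 : 0 < e3)
    (hn1 : Squarefree n1) (hn2 : Squarefree n2) (hn3 : Squarefree n3) (hR : 0 < R)
    (S : Finset (ℕ × ℕ × ℕ)) (hS : ∀ a ∈ S, Sol e1 e2 e3 n1 n2 n3 R a) :
    (S.card : ℝ) ≤ 2 * (n1.divisors.card * n2.divisors.card * n3.divisors.card) *
      (2 * R / √((n1 * n2 * n3 : ℕ) : ℝ) + 1) := by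
  classical
  rcases S.eq_empty_or_nonempty with rfl | ⟨b, hbS⟩
  · simp; positivity
  have hb := hS b hbS
  have n1pos : 0 < n1 := Nat.pos_of_ne_zero hn1.ne_zero
  have n2pos : 0 < n2 := Nat.pos_of_ne_zero hn2.ne_zero
  have n3pos : 0 < n3 := Nat.pos_of_ne_zero hn3.ne_zero
  set N : ℝ := ((n1 * n2 * n3 : ℕ) : ℝ) with hN
  have hNpos : 0 < N := by rw [hN]; exact_mod_cast (by positivity : 0 < n1 * n2 * n3)
  have hsN : 0 < √N := Real.sqrt_pos.2 hNpos
  set c1 : ℝ := ((e1 * n1 : ℕ) : ℝ) with hc1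
  set c2 : ℝ := ((e2 * n2 : ℕ) : ℝ) with hc2
  set c3 : ℝ := ((e3 * n3 : ℕ) : ℝ) with hc3
  have c1p : 0 < c1 := by rw [hc1]; exact_mod_cast (by positivity : 0 < e1 * n1)
  have c2p : 0 < c2 := by rw [hc2]; exact_mod_cast (by positivity : 0 < e2 * n2)
  have c3p : 0 < c3 := by rw [hc3]; exact_mod_cast (by positivity : 0 < e3 * n3)
  have hNc : N ≤ c1 * c2 * c3 := by
    rw [hN, hc1, hc2, hc3]
    norm_cast
    gcongr <;> nlinarith
  have hpar : ∀ a ∈ S, _ := fun a ha => param (a := a) c1p c2p c3p hR (hS a ha).p1 (hS a ha).p2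
    (hS a ha).p3
    (by have := (hS a ha).eq
        rw [hc1, hc2, hc3]; exact_mod_cast this)
    (by have := (hS a ha).le
        rw [hc3]; exact_mod_cast this)
  set f : ℕ × ℕ × ℕ → (ℕ × ℕ × ℕ) × ℕ := fun a =>
    ((cls n1 a.2.1 a.2.2 b.2.1 b.2.2, cls n2 a.1 a.2.2 b.1 b.2.2, cls n3 a.1 a.2.1 b.1 b.2.1),
      ⌊tval c1 c2 c3 a * (2 * R / √N)⌋₊) with hf
  set T : Finset ((ℕ × ℕ × ℕ) × ℕ) := (n1.divisors ×ˢ n2.divisors ×ˢ n3.divisors) ×ˢ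
    Finset.range (⌊2 * R / √N⌋₊ + 1) with hT
  have hK : 0 < 2 * R / √N := by positivity
  have hmaps : ∀ a ∈ S, f a ∈ T := by
    intro a ha
    simp only [hf, hT, Finset.mem_product, Finset.mem_range]
    refine ⟨⟨cls_mem _ _ _ _ _ n1pos.ne', cls_mem _ _ _ _ _ n2pos.ne',
      cls_mem _ _ _ _ _ n3pos.ne'⟩, ?_⟩
    apply Nat.lt_succ_of_le
    apply Nat.floor_le_floor
    have := (hpar a ha).2.2.2.1
    nlinarith
  have tinj : ∀ a ∈ S, ∀ a' ∈ S, tval c1 c2 c3 a = tval c1 c2 c3 a' → a = a' := by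
    intro a ha a' ha' ht
    obtain ⟨k0, -, -, -, x1, x2, x3⟩ := hpar a ha
    obtain ⟨k0', -, -, -, x1', x2', x3'⟩ := hpar a' ha'
    rw [← ht] at x1' x2' x3'
    have h12 : (a.1 : ℝ) * a'.2.1 = a.2.1 * a'.1 := by
      have hs : √c1 * √c2 ≠ 0 := by positivity
      apply mul_left_cancel₀ hs
      calc √c1 * √c2 * ((a.1 : ℝ) * a'.2.1) = (√c1 * a.1) * (√c2 * a'.2.1) := by ring
        _ = (√c2 * a.2.1) * (√c1 * a'.1) := by rw [x1, x2, x1', x2']; ring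
        _ = _ := by ring
    have h12' : a.1 * a'.2.1 = a.2.1 * a'.1 := by exact_mod_cast h12
    have C := (hS a ha).c
    have C' := (hS a' ha').c
    have d1 : a.1 ∣ a'.1 := C.dvd_of_dvd_mul_left (h12' ▸ dvd_mul_right _ _)
    have d1' : a'.1 ∣ a.1 := C'.dvd_of_dvd_mul_right (h12' ▸ dvd_mul_left _ _)
    have E1 : a.1 = a'.1 := Nat.dvd_antisymm d1 d1'
    have E2 : a.2.1 = a'.2.1 := by
      rw [E1, mul_comm] at h12'
      exact (Nat.eq_of_mul_eq_mul_right (hS a' ha').p1 h12').symm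
    have E3 : a.2.2 = a'.2.2 := by
      have q := (hS a ha).eq
      have q' := (hS a' ha').eq
      rw [E1, E2, q'] at q
      have := Nat.eq_of_mul_eq_mul_left (by positivity) q
      exact (Nat.pow_left_injective (by norm_num : 2 ≠ 0) this).symm
    exact Prod.ext E1 (Prod.ext E2 E3)
  have hfib : ∀ y ∈ T, (S.filter (fun a => f a = y)).card ≤ 2 := by
    intro y _
    by_contra hlt
    push Not at hlt
    obtain ⟨u, hu, v, hv, w, hw, huv, huw, hvw⟩ := Finset.two_lt_card.1 hlt
    rw [Finset.mem_filter] at hu hv hw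
    obtain ⟨hu, fu⟩ := hu
    obtain ⟨hv, fv⟩ := hv
    obtain ⟨hw, fw⟩ := hw
    have close : ∀ a ∈ S, ∀ a' ∈ S, f a = f a' →
        |tval c1 c2 c3 a - tval c1 c2 c3 a'| ≤ √N / (2 * R) := by
      intro a ha a' ha' h
      have h2 : ⌊tval c1 c2 c3 a * (2 * R / √N)⌋₊ = ⌊tval c1 c2 c3 a' * (2 * R / √N)⌋₊ :=
        congrArg Prod.snd h
      have t0 := (hpar a ha).2.2.1
      have t0' := (hpar a' ha').2.2.1
      have f1 := Nat.floor_le (mul_nonneg t0 hK.le)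
      have f2 := Nat.lt_floor_add_one (tval c1 c2 c3 a * (2 * R / √N))
      have f1' := Nat.floor_le (mul_nonneg t0' hK.le)
      have f2' := Nat.lt_floor_add_one (tval c1 c2 c3 a' * (2 * R / √N))
      rw [h2] at f1 f2
      have : |tval c1 c2 c3 a - tval c1 c2 c3 a'| * (2 * R / √N) ≤ 1 := by
        have habs : |tval c1 c2 c3 a - tval c1 c2 c3 a'| * (2 * R / √N) =
            |(tval c1 c2 c3 a - tval c1 c2 c3 a') * (2 * R / √N)| := by
          rw [abs_mul, abs_of_pos hK]
        rw [habs, abs_le]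
        constructor <;> linarith
      rw [← le_div_iff₀ hK] at this
      rwa [one_div_div] at this
    have cl : ∀ a ∈ S, ∀ a' ∈ S, f a = f a' →
        (n1 : ℤ) ∣ a.2.1 * a'.2.2 - a.2.2 * a'.2.1 ∧ (n2 : ℤ) ∣ a.1 * a'.2.2 - a.2.2 * a'.1 ∧
        (n3 : ℤ) ∣ a.1 * a'.2.1 - a.2.1 * a'.1 := by
      intro a ha a' ha' h
      simp only [hf, Prod.mk.injEq] at h
      exact ⟨minor23 hn1 (hS a ha) (hS a' ha') hb h.1.1, minor13 hn2 (hS a ha) (hS a' ha') hb h.1.2.1,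
        minor12 hn3 (hS a ha) (hS a' ha') hb h.1.2.2⟩
    have fuv : f u = f v := fu.trans fv.symm
    have fuw : f u = f w := fu.trans fw.symm
    have fvw : f v = f w := fv.trans fw.symm
    obtain ⟨m1, m2, m3⟩ := cl u hu v hv fuv
    obtain ⟨m1', m2', m3'⟩ := cl u hu w hw fuw
    obtain ⟨m1'', m2'', m3''⟩ := cl v hv w hw fvw
    have dd := det_dvd (hS u hu) m1'' m1 m1' m2'' m2 m2' m3'' m3 m3'
    have hdet : detZ u v w = 0 ∨ N ≤ |(detZ u v w : ℝ)| := by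
      by_cases h0 : detZ u v w = 0
      · exact Or.inl h0
      · right
        have := Int.le_of_dvd (abs_pos.2 h0) ((dvd_abs _ _).2 dd)
        rw [hN]
        exact_mod_cast this
    obtain ⟨ku, ku', -, -, u1, u2, u3⟩ := hpar u hu
    obtain ⟨kv, kv', -, -, v1, v2, v3⟩ := hpar v hv
    obtain ⟨kw, kw', -, -, w1, w2, w3⟩ := hpar w hw
    have := three_pts c1p c2p c3p u1 u2 u3 v1 v2 v3 w1 w2 w3 ku kv kw ku' kv' kw'
      (close u hu v hv fuv) (close u hu w hw fuw) (close v hv w hw fvw) hNpos hNc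
      (by apply le_of_eq; field_simp) hdet
    rcases this with h | h | h
    · exact huv (tinj _ hu _ hv h)
    · exact huw (tinj _ hu _ hw h)
    · exact hvw (tinj _ hv _ hw h)
  have hcard := Finset.card_le_mul_card_image_of_maps_to hmaps 2 hfib
  have hTc : T.card = n1.divisors.card * n2.divisors.card * n3.divisors.card *
      (⌊2 * R / √N⌋₊ + 1) := by
    simp [hT, Finset.card_product, mul_assoc]
  rw [hTc] at hcard
  have hcard' : (S.card : ℝ) ≤ 2 * (n1.divisors.card * n2.divisors.card * n3.divisors.card *
      (⌊2 * R / √N⌋₊ + 1)) := by exact_mod_cast hcard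
  refine hcard'.trans ?_
  rw [mul_assoc 2]
  gcongr
  exact Nat.floor_le hK.le

end

theorem sum_tau (K : ℕ) :
    ∑ n ∈ Finset.Icc 1 K, (n.divisors.card : ℝ) / n ≤ (∑ n ∈ Finset.Icc 1 K, ((n : ℝ))⁻¹) ^ 2 := by
  classical
  rw [sq, Finset.sum_mul_sum, ← Finset.sum_product']
  set B := Finset.Icc 1 K ×ˢ Finset.Icc 1 K with hB
  calc ∑ n ∈ Finset.Icc 1 K, (n.divisors.card : ℝ) / n
      ≤ ∑ n ∈ Finset.Icc 1 K, ∑ x ∈ (B.filter (fun x => x.1 * x.2 ∈ Finset.Icc 1 K)).filter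
          (fun x => x.1 * x.2 = n), ((x.1 : ℝ))⁻¹ * ((x.2 : ℝ))⁻¹ := by
        apply Finset.sum_le_sum
        intro n hn
        rw [Finset.mem_Icc] at hn
        have h1 : (B.filter (fun x => x.1 * x.2 ∈ Finset.Icc 1 K)).filter
          (fun x => x.1 * x.2 = n) = n.divisorsAntidiagonal := by
          ext ⟨g, h⟩
          simp only [hB, Finset.mem_filter, Finset.mem_product, Finset.mem_Icc,
            Nat.mem_divisorsAntidiagonal]
          constructor
          · rintro ⟨_, h⟩
            exact ⟨h, by omega⟩
          · rintro ⟨rfl, h0⟩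
            have hg : 0 < g := Nat.pos_of_ne_zero (by rintro rfl; simp at h0)
            have hh : 0 < h := Nat.pos_of_ne_zero (by rintro rfl; simp at h0)
            refine ⟨⟨⟨⟨hg, ?_⟩, ⟨hh, ?_⟩⟩, hn⟩, rfl⟩ <;> nlinarith
        rw [h1]
        have h2 : ∀ x ∈ n.divisorsAntidiagonal, ((x.1 : ℝ))⁻¹ * ((x.2 : ℝ))⁻¹ = (n : ℝ)⁻¹ := by
          intro x hx
          rw [← mul_inv, ← (Nat.mem_divisorsAntidiagonal.1 hx).1]
          push_cast; rfl
        rw [Finset.sum_congr rfl h2, Finset.sum_const, nsmul_eq_mul,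
          ← Nat.map_div_right_divisors, Finset.card_map]
        rfl
    _ = ∑ x ∈ B.filter (fun x => x.1 * x.2 ∈ Finset.Icc 1 K), ((x.1 : ℝ))⁻¹ * ((x.2 : ℝ))⁻¹ := by
        apply Finset.sum_fiberwise_of_maps_to
        intro x hx
        exact (Finset.mem_filter.1 hx).2
    _ ≤ ∑ x ∈ B, ((x.1 : ℝ))⁻¹ * ((x.2 : ℝ))⁻¹ := by
        apply Finset.sum_le_sum_of_subset_of_nonneg (Finset.filter_subset _ _)
        intros; positivity

theorem sum_tau_log (Y : ℝ) (hY : 1 ≤ Y) :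
    ∑ n ∈ Finset.Icc 1 ⌊Y⌋₊, (n.divisors.card : ℝ) / n ≤ (1 + Real.log Y) ^ 2 := by
  refine (sum_tau _).trans ?_
  have h := harmonic_floor_le_one_add_log Y hY
  rw [harmonic_eq_sum_Icc] at h
  push_cast at h
  gcongr

theorem triple_sum (I : Finset ℕ) (τ : ℕ → ℝ) :
    ∑ n ∈ I ×ˢ I ×ˢ I, τ n.1 * (τ n.2.1 * τ n.2.2) = (∑ n ∈ I, τ n) ^ 3 := by
  rw [pow_succ', sq, Finset.sum_mul_sum, ← Finset.sum_product', Finset.sum_mul_sum,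
    ← Finset.sum_product']

theorem total_count {e1 e2 e3 : ℕ} {R Y : ℝ} (he1 : 0 < e1) (he2 : 0 < e2) (he3 : 0 < e3)
    (hR : 0 < R) (hY : 1 ≤ Y) (T : Finset ((ℕ × ℕ × ℕ) × (ℕ × ℕ × ℕ)))
    (hT : ∀ x ∈ T, Squarefree x.1.1 ∧ Squarefree x.1.2.1 ∧ Squarefree x.1.2.2 ∧
      ((x.1.1 * x.1.2.1 * x.1.2.2 : ℕ) : ℝ) ≤ Y ∧ Sol e1 e2 e3 x.1.1 x.1.2.1 x.1.2.2 R x.2) :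
    (T.card : ℝ) ≤ 2 * (Y + 2 * R * √Y) * (1 + Real.log Y) ^ 6 := by
  classical
  set I := Finset.Icc 1 ⌊Y⌋₊ with hI
  set B := I ×ˢ I ×ˢ I with hB
  have hmaps : ∀ x ∈ T, x.1 ∈ B := by
    rintro ⟨⟨n1, n2, n3⟩, a⟩ hx
    obtain ⟨s1, s2, s3, hle, -⟩ := hT _ hx
    have p1 : 0 < n1 := Nat.pos_of_ne_zero s1.ne_zero
    have p2 : 0 < n2 := Nat.pos_of_ne_zero s2.ne_zero
    have p3 : 0 < n3 := Nat.pos_of_ne_zero s3.ne_zero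
    have hle' := Nat.le_floor hle
    simp only at hle'
    simp only [hB, hI, Finset.mem_product, Finset.mem_Icc]
    have d1 := Nat.le_of_dvd (by positivity) (Dvd.intro (n2 * n3) rfl : n1 ∣ n1 * (n2 * n3))
    have d2 := Nat.le_of_dvd (by positivity) (Dvd.intro (n1 * n3) rfl : n2 ∣ n2 * (n1 * n3))
    have d3 := Nat.le_of_dvd (by positivity) (Dvd.intro (n1 * n2) rfl : n3 ∣ n3 * (n1 * n2))
    refine ⟨⟨p1, ?_⟩, ⟨p2, ?_⟩, ⟨p3, ?_⟩⟩ <;> nlinarith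
  rw [Finset.card_eq_sum_card_fiberwise hmaps]
  push_cast
  set τ : ℕ → ℝ := fun n => (n.divisors.card : ℝ) / n with hτ
  have hfib : ∀ n ∈ B, ((T.filter (fun x => x.1 = n)).card : ℝ) ≤
      2 * (Y + 2 * R * √Y) * (τ n.1 * (τ n.2.1 * τ n.2.2)) := by
    rintro ⟨n1, n2, n3⟩ hn
    have hpos : 0 ≤ 2 * (Y + 2 * R * √Y) * (τ n1 * (τ n2 * τ n3)) := by
      simp only [hτ]; positivity
    rcases (T.filter (fun x => x.1 = (n1, n2, n3))).eq_empty_or_nonempty with h | ⟨x, hx⟩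
    · rw [h]; simpa using hpos
    · obtain ⟨hx1, hx2⟩ := Finset.mem_filter.1 hx
      obtain ⟨s1, s2, s3, hle, -⟩ := hT x hx1
      rw [hx2] at s1 s2 s3 hle
      simp only at s1 s2 s3 hle
      have hc : (T.filter (fun x => x.1 = (n1, n2, n3))).card =
          ((T.filter (fun x => x.1 = (n1, n2, n3))).image Prod.snd).card := by
        symm
        apply Finset.card_image_of_injOn
        intro u hu v hv huv
        have hu' := (Finset.mem_filter.1 hu).2
        have hv' := (Finset.mem_filter.1 hv).2
        exact Prod.ext (hu'.trans hv'.symm) huv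
      rw [hc]
      refine (conic_count he1 he2 he3 s1 s2 s3 hR _ ?_).trans ?_
      · intro a ha
        obtain ⟨u, hu, rfl⟩ := Finset.mem_image.1 ha
        obtain ⟨hu1, hu2⟩ := Finset.mem_filter.1 hu
        have := (hT u hu1).2.2.2.2
        rw [hu2] at this
        exact this
      · have p1 : (0 : ℝ) < n1 := by exact_mod_cast Nat.pos_of_ne_zero s1.ne_zero
        have p2 : (0 : ℝ) < n2 := by exact_mod_cast Nat.pos_of_ne_zero s2.ne_zero
        have p3 : (0 : ℝ) < n3 := by exact_mod_cast Nat.pos_of_ne_zero s3.ne_zero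
        push_cast at hle ⊢
        set N : ℝ := (n1 : ℝ) * n2 * n3 with hN
        have hNp : 0 < N := by positivity
        have hs : √N * √N = N := Real.mul_self_sqrt hNp.le
        have hs0 : 0 < √N := Real.sqrt_pos.2 hNp
        have hsY : √N ≤ √Y := Real.sqrt_le_sqrt hle
        have key : 2 * R / √N + 1 ≤ (Y + 2 * R * √Y) / N := by
          rw [le_div_iff₀ hNp]
          have : (2 * R / √N + 1) * N = 2 * R * √N + N := by
            rw [add_mul, one_mul]
            congr 1
            rw [div_mul_eq_mul_div, div_eq_iff hs0.ne', mul_assoc _ (√N), hs]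
          rw [this]
          nlinarith
        calc _ ≤ 2 * ((n1.divisors.card : ℝ) * n2.divisors.card * n3.divisors.card) *
              ((Y + 2 * R * √Y) / N) := by gcongr
          _ = _ := by
              simp only [hτ, hN]
              field_simp
  refine (Finset.sum_le_sum hfib).trans ?_
  rw [← Finset.mul_sum]
  rw [hB, triple_sum]
  have h0 : 0 ≤ ∑ n ∈ I, τ n := Finset.sum_nonneg (fun n _ => div_nonneg (Nat.cast_nonneg _) (Nat.cast_nonneg _))
  have h1 := sum_tau_log Y hY
  have hpos2 : 0 ≤ 2 * (Y + 2 * R * √Y) := by positivity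
  calc _ ≤ 2 * (Y + 2 * R * √Y) * ((1 + Real.log Y) ^ 2) ^ 3 :=
        mul_le_mul_of_nonneg_left (pow_le_pow_left₀ h0 h1 3) hpos2
    _ = _ := by rw [← pow_mul]

theorem sqfree_unique {a b u v : ℕ} (ha : Squarefree a) (hb : Squarefree b) (hv : 0 < v)
    (h : a * u ^ 2 = b * v ^ 2) : a = b := by
  have key : ∀ {a b u v : ℕ}, Squarefree a → Squarefree b → 0 < v →
      a * u ^ 2 = b * v ^ 2 → a ∣ b := by
    intro a b u v ha hb hv h
    have h1 : v ^ 2 ∣ (a * u) ^ 2 := ⟨a * b, by rw [mul_pow]; nlinarith⟩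
    obtain ⟨k, hk⟩ := (Nat.pow_dvd_pow_iff (by norm_num)).1 h1
    have h2 : k ^ 2 = a * b := by
      apply Nat.eq_of_mul_eq_mul_left (by positivity : 0 < v ^ 2)
      rw [← mul_pow, ← hk, mul_pow]; nlinarith
    have h3 : a ∣ k := (ha.dvd_pow_iff_dvd (by norm_num : (2 : ℕ) ≠ 0)).1 (h2 ▸ dvd_mul_right _ _)
    obtain ⟨m, rfl⟩ := h3
    have : a * m ^ 2 = b := by
      apply Nat.eq_of_mul_eq_mul_left (Nat.pos_of_ne_zero ha.ne_zero)
      nlinarith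
    exact ⟨m ^ 2, this.symm⟩
  have hu : 0 < u := by
    rcases Nat.eq_zero_or_pos u with rfl | h'
    · have : 0 < b * v ^ 2 := by have := Nat.pos_of_ne_zero hb.ne_zero; positivity
      rw [← h] at this; simp at this
    · exact h'
  exact Nat.dvd_antisymm (key ha hb hv h) (key hb ha hu h.symm)

structure PtRep (d : ℕ) (M : ℝ) (w x z : ℕ) : Prop where
  w0 : 0 < w
  x0 : 0 < x
  z0 : 0 < z
  cop : Nat.Coprime w x
  odd : Odd w
  eq : w * x * (w + x) * (w + 2 * x) = d * z ^ 2
  le : ((w + x : ℕ) : ℝ) ≤ M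

theorem rep_of_nat {d P Q z : ℕ} {M : ℝ} (hd : Squarefree d) (hQ : 0 < Q) (hPQ : Q < P)
    (hz : 0 < z) (hc : Nat.Coprime P Q) (hM : (P : ℝ) ≤ M)
    (h : P * Q * (P - Q) * (P + Q) = d * z ^ 2) : ∃ w x z, PtRep d M w x z := by
  obtain ⟨w, rfl⟩ := Nat.exists_eq_add_of_lt hPQ
  have e1 : Q + w + 1 - Q = w + 1 := by omega
  rw [e1] at h
  have hc1 : Nat.Coprime (w + 1) Q := by
    rw [add_assoc] at hc; simpa using hc
  rcases Nat.even_or_odd (w + 1) with hev | hodd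
  · skip
    obtain ⟨x, hx⟩ := hev
    have hQodd : Odd Q := by
      rcases Nat.even_or_odd Q with h' | h'
      · exfalso
        have : 2 ∣ Nat.gcd (w + 1) Q := Nat.dvd_gcd ⟨x, by omega⟩ h'.two_dvd
        rw [hc1] at this; omega
      · exact h'
    have h2z : 2 ∣ z := by
      by_contra hn
      have hco : Nat.Coprime 4 (z ^ 2) := by
        have : Nat.Coprime 2 z := (Nat.Prime.coprime_iff_not_dvd Nat.prime_two).2 hn
        exact Nat.Coprime.pow 2 2 this
      have : 4 ∣ d * z ^ 2 := by
        rw [← h]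
        exact ⟨(Q + w + 1) * Q * x * (x + Q), by rw [add_assoc, hx]; ring⟩
      have h4 : 2 * 2 ∣ d := hco.dvd_of_dvd_mul_right this
      have := hd 2 h4
      simp at this
    obtain ⟨z', rfl⟩ := h2z
    refine ⟨Q, x, z', hQ, by omega, by omega, ?_, hQodd, ?_, ?_⟩
    · rw [hx, ← two_mul] at hc1
      exact (Nat.Coprime.coprime_mul_left hc1).symm
    · rw [add_assoc, hx] at h
      nlinarith
    · refine le_trans ?_ hM
      exact_mod_cast (by omega)
  · refine ⟨w + 1, Q, z, by omega, hQ, hz, hc1, hodd, ?_, ?_⟩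
    · rw [← h]; ring
    · refine le_trans (le_of_eq ?_) hM
      push_cast; ring

theorem rep_of_pt {d p q : ℤ} {y : ℚ} {M : ℝ} (hd1 : 1 ≤ d) (hd : Squarefree d)
    (hc : Int.gcd p q = 1) (hq : 1 ≤ q) (hy : y ≠ 0)
    (h : (d : ℚ) * y ^ 2 = ((p : ℚ) / (q : ℚ)) ^ 3 - (p : ℚ) / (q : ℚ))
    (hM : max |(p : ℝ)| (q : ℝ) ≤ M) : ∃ w x z, PtRep d.natAbs M w x z := by
  have hq0 : (q : ℚ) ≠ 0 := by exact_mod_cast (by omega : q ≠ 0)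
  set r : ℚ := y * q ^ 2 with hr
  have hr0 : r ≠ 0 := by rw [hr]; positivity
  have h1 : (d : ℚ) * r ^ 2 = ((p * q * (p - q) * (p + q) : ℤ) : ℚ) := by
    rw [hr, mul_pow, ← mul_assoc, h]
    push_cast
    field_simp
    ring
  have h2 : d * r.num ^ 2 = (p * q * (p - q) * (p + q)) * (r.den : ℤ) ^ 2 := by
    have hden : (r.den : ℚ) ≠ 0 := by exact_mod_cast r.den_nz
    have h3 : (r.num : ℚ) = r * r.den := (Rat.mul_den_eq_num r).symm
    have : (d : ℚ) * (r.num : ℚ) ^ 2 = ((p * q * (p - q) * (p + q) : ℤ) : ℚ) * (r.den : ℚ) ^ 2 := by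
      rw [h3, mul_pow, ← mul_assoc, h1]
    exact_mod_cast this
  have hcop : IsCoprime (r.den : ℤ) r.num := by
    rw [Int.isCoprime_iff_gcd_eq_one, Int.gcd_comm]
    exact r.reduced
  have h3 : (r.den : ℤ) * r.den ∣ d := by
    have : (r.den : ℤ) ^ 2 ∣ d * r.num ^ 2 := ⟨_, h2.trans (mul_comm _ _)⟩
    have := (hcop.pow (m := 2) (n := 2)).dvd_of_dvd_mul_right this
    rwa [sq] at this
  have h4 : (r.den : ℤ) ^ 2 = 1 := by
    rcases Int.isUnit_iff.1 (hd _ h3) with h | h <;> rw [h] <;> norm_num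
  rw [h4, mul_one] at h2
  set z := r.num with hz
  have hz0 : z ≠ 0 := by rw [hz]; exact Rat.num_ne_zero.2 hr0
  have hdn : Squarefree d.natAbs := Int.squarefree_natAbs.2 hd
  have hpos : 0 < p * q * (p - q) * (p + q) := by rw [← h2]; positivity
  obtain ⟨hMp, hMq⟩ := max_le_iff.1 hM
  rcases lt_trichotomy p 0 with hp | hp | hp
  · skip
    have hlt : -p < q := by
      by_contra hn
      have h5 : 0 ≤ -p - q := by omega
      have h6 : 0 ≤ (-p) * q * (q - p) := by
        have : 0 < -p := by omega
        have : 0 < q - p := by omega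
        positivity
      nlinarith [mul_nonneg h6 h5]
    obtain ⟨Q, hQ⟩ := Int.eq_ofNat_of_zero_le (by omega : 0 ≤ -p)
    obtain ⟨P, hP⟩ := Int.eq_ofNat_of_zero_le (by omega : 0 ≤ q)
    have hpQ : p = -(Q : ℤ) := by omega
    subst hpQ
    subst hP
    have hQP : Q < P := by omega
    refine rep_of_nat (z := z.natAbs) hdn (by omega) hQP (by omega) (P := P) (Q := Q) ?_ ?_ ?_
    · rw [Int.neg_gcd] at hc
      rw [Nat.coprime_comm]
      simpa [Int.gcd] using hc
    · exact_mod_cast hMq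
    · zify [hQP.le]
      rw [sq_abs, abs_of_pos (by omega), h2]
      ring
  · subst hp; simp at hpos
  · have hlt : q < p := by
      by_contra hn
      have h5 : 0 ≤ q - p := by omega
      have h6 : 0 ≤ p * q * (p + q) := by
        have : 0 < q := by omega
        positivity
      nlinarith [mul_nonneg h6 h5]
    obtain ⟨P, hP⟩ := Int.eq_ofNat_of_zero_le (by omega : 0 ≤ p)
    obtain ⟨Q, hQ⟩ := Int.eq_ofNat_of_zero_le (by omega : 0 ≤ q)
    subst hP
    subst hQ
    have hQP : Q < P := by omega
    refine rep_of_nat (z := z.natAbs) hdn (by omega) hQP (by omega) (P := P) (Q := Q) ?_ ?_ ?_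
    · simpa [Int.gcd] using hc
    · have := (le_abs_self _).trans hMp
      exact_mod_cast this
    · zify [hQP.le]
      rw [sq_abs, abs_of_pos (by omega), h2]

theorem sol_mk {e1 e2 e3 n1 n2 n3 a1 a2 a3 u1 u2 u3 : ℕ} {R : ℝ}
    (h1 : a1 ^ 2 * n1 = u1) (h2 : a2 ^ 2 * n2 = u2) (h3 : a3 ^ 2 * n3 = u3)
    (p1 : 0 < a1) (p2 : 0 < a2) (p3 : 0 < a3)
    (eq : e1 * u1 + e2 * u2 = e3 * u3) (le : ((e3 * u3 : ℕ) : ℝ) ≤ R ^ 2)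
    (c12 : Nat.Coprime u1 u2) (c13 : Nat.Coprime u1 u3) (c23 : Nat.Coprime u2 u3)
    (d12 : Nat.Coprime u1 e2) (d13 : Nat.Coprime u1 e3) (d21 : Nat.Coprime u2 e1)
    (d23 : Nat.Coprime u2 e3) (d31 : Nat.Coprime u3 e1) (d32 : Nat.Coprime u3 e2) :
    Sol e1 e2 e3 n1 n2 n3 R (a1, a2, a3) := by
  have key : ∀ {u v e n m a b : ℕ}, a ^ 2 * n = u → b ^ 2 * m = v → Nat.Coprime u v →
      Nat.Coprime u e → Nat.Coprime n (e * m * b) := by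
    intro u v e n m a b hu hv h1 h2
    subst hu; subst hv
    have h3 : Nat.Coprime n (b ^ 2 * m) := Nat.Coprime.coprime_mul_left h1
    have h4 : Nat.Coprime n e := Nat.Coprime.coprime_mul_left h2
    refine (h4.mul_right (Nat.Coprime.coprime_mul_left_right h3)).mul_right ?_
    exact (Nat.coprime_pow_right_iff (by norm_num) _ _).1 (Nat.Coprime.coprime_mul_right_right h3)
  refine ⟨p1, p2, p3, ?_, ?_, key h1 h2 c12 d12, key h1 h3 c13 d13, key h2 h1 c12.symm d21,
    key h2 h3 c23 d23, key h3 h1 c13.symm d31, key h3 h2 c23.symm d32, ?_⟩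
  · simp only
    rw [← h1, ← h2, ← h3] at eq
    nlinarith
  · refine le_trans (le_of_eq ?_) le
    rw [← h3]; congr 1; simp only; ring
  · subst h1 h2
    have := Nat.Coprime.coprime_mul_right (Nat.Coprime.coprime_mul_right_right c12)
    exact (Nat.coprime_pow_left_iff (by norm_num) _ _).1
      ((Nat.coprime_pow_right_iff (by norm_num) _ _).1 this)

def TCond (e1 e2 e3 : ℕ) (R Y : ℝ) (x : (ℕ × ℕ × ℕ) × (ℕ × ℕ × ℕ)) : Prop :=
  Squarefree x.1.1 ∧ Squarefree x.1.2.1 ∧ Squarefree x.1.2.2 ∧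
      ((x.1.1 * x.1.2.1 * x.1.2.2 : ℕ) : ℝ) ≤ Y ∧ Sol e1 e2 e3 x.1.1 x.1.2.1 x.1.2.2 R x.2

theorem type_count {e1 e2 e3 : ℕ} {R Y : ℝ} (he1 : 0 < e1) (he2 : 0 < e2) (he3 : 0 < e3)
    (hR : 0 < R) (hY : 1 ≤ Y) (F G : (ℕ × ℕ × ℕ) × (ℕ × ℕ × ℕ) → ℕ) (D : Finset ℕ)
    (hD : ∀ d ∈ D, Squarefree d ∧ ∃ t, TCond e1 e2 e3 R Y t ∧ ∃ z, 0 < z ∧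
      F t * G t * (F t + G t) * (F t + 2 * G t) = d * z ^ 2) :
    (D.card : ℝ) ≤ 2 * (Y + 2 * R * √Y) * (1 + Real.log Y) ^ 6 := by
  classical
  choose! f hf using fun d hd => (hD d hd).2
  have hc : (D.image f).card = D.card := by
    apply Finset.card_image_of_injOn
    intro d hd d' hd' h
    obtain ⟨-, z, hz, h1⟩ := hf d hd
    obtain ⟨-, z', hz', h2⟩ := hf d' hd'
    rw [h, h2] at h1
    exact (sqfree_unique (hD d' hd').1 (hD d hd).1 hz h1).symm
  rw [← hc]
  apply total_count he1 he2 he3 hR hY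
  intro t ht
  obtain ⟨d, hd, rfl⟩ := Finset.mem_image.1 ht
  exact (hf d hd).1

def Typ (e1 e2 e3 : ℕ) (R Y : ℝ) (F G : (ℕ × ℕ × ℕ) × (ℕ × ℕ × ℕ) → ℕ) (d : ℕ) : Prop :=
  ∃ t, TCond e1 e2 e3 R Y t ∧ ∃ z, 0 < z ∧
      F t * G t * (F t + G t) * (F t + 2 * G t) = d * z ^ 2

def Fa : (ℕ × ℕ × ℕ) × (ℕ × ℕ × ℕ) → ℕ := fun t => t.2.1 ^ 2 * t.1.1
def Fb : (ℕ × ℕ × ℕ) × (ℕ × ℕ × ℕ) → ℕ := fun t => t.2.2.1 ^ 2 * t.1.2.1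
def Fc : (ℕ × ℕ × ℕ) × (ℕ × ℕ × ℕ) → ℕ := fun t => (Fb t - Fa t) / 2
def Fd : (ℕ × ℕ × ℕ) × (ℕ × ℕ × ℕ) → ℕ := fun t => Fb t - Fa t

theorem three_quarter_bound {A s d : ℕ} {X Y : ℝ} (hA : A * s = d) (h : A ≤ s ^ 3) (hd : (d : ℝ) ≤ X)
    (hY : 0 ≤ Y) (hXY : Y ^ 4 = X ^ 3) : (A : ℝ) ≤ Y := by
  have h1 : A ^ 4 ≤ d ^ 3 := by
    rw [← hA, mul_pow, pow_succ]
    gcongr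
  have h2 : (A : ℝ) ^ 4 ≤ Y ^ 4 := by
    rw [hXY]
    calc (A : ℝ) ^ 4 ≤ (d : ℝ) ^ 3 := by exact_mod_cast h1
      _ ≤ X ^ 3 := by gcongr
  exact (pow_le_pow_iff_left₀ (Nat.cast_nonneg _) hY (by norm_num)).1 h2

theorem cube_le {a b c s : ℕ} (ha : a ≤ s) (hb : b ≤ s) (hc : c ≤ s) : a * b * c ≤ s ^ 3 := by
  calc a * b * c ≤ s * s * s := by gcongr
    _ = s ^ 3 := by ring

theorem rep_types {d w x z : ℕ} {M X Y R : ℝ} (h : PtRep d M w x z) (hd : Squarefree d)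
    (hX : (d : ℝ) ≤ X) (hY : 0 ≤ Y) (hXY : Y ^ 4 = X ^ 3) (hR : R ^ 2 = 2 * M) :
    Typ 1 1 1 R Y Fa Fb d ∨ Typ 1 2 1 R Y Fa Fb d ∨ Typ 1 1 2 R Y Fa Fc d ∨
      Typ 1 1 1 R Y Fd Fa d := by
  obtain ⟨w0, x0, z0, cop, odd, eq, le⟩ := h
  obtain ⟨s1, a1, s1p, a1p, h1, q1⟩ := Nat.sq_mul_squarefree_of_pos w0
  obtain ⟨s2, a2, s2p, a2p, h2, q2⟩ := Nat.sq_mul_squarefree_of_pos x0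
  obtain ⟨s3, a3, s3p, a3p, h3, q3⟩ := Nat.sq_mul_squarefree_of_pos (by omega : 0 < w + x)
  obtain ⟨s4, a4, s4p, a4p, h4, q4⟩ := Nat.sq_mul_squarefree_of_pos (by omega : 0 < w + 2 * x)
  have w2 : Nat.Coprime w 2 := Nat.coprime_two_right.2 odd
  have c12 : Nat.Coprime w x := cop
  have c13 : Nat.Coprime w (w + x) := by simpa using cop
  have c14 : Nat.Coprime w (w + 2 * x) := by
    simpa using w2.mul_right cop
  have c23 : Nat.Coprime x (w + x) := by simpa using cop.symm
  have c24 : Nat.Coprime x (w + 2 * x) := by simpa using cop.symm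
  have c34 : Nat.Coprime (w + x) (w + 2 * x) := by
    have : w + 2 * x = (w + x) + x := by ring
    rw [this]
    simpa using c23.symm
  have v2 : Nat.Coprime (w + 2 * x) 2 :=
    Nat.coprime_two_right.2 (odd.add_even (even_two_mul x))
  have M0 : (0 : ℝ) ≤ M := (Nat.cast_nonneg _).trans le
  have le1 : ((1 * (w + x) : ℕ) : ℝ) ≤ R ^ 2 := by rw [hR, one_mul]; linarith
  have le2 : ((2 * (w + x) : ℕ) : ℝ) ≤ R ^ 2 := by rw [hR]; push_cast at le ⊢; linarith
  have le3 : ((1 * (w + 2 * x) : ℕ) : ℝ) ≤ R ^ 2 := by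
    refine le_trans ?_ le2
    exact_mod_cast (by omega)
  have dvd_of : ∀ {a s u : ℕ}, a ^ 2 * s = u → s ∣ u := fun h => ⟨_, (h.symm.trans (mul_comm _ _))⟩
  have cs : ∀ {a s u b t v : ℕ}, a ^ 2 * s = u → b ^ 2 * t = v → Nat.Coprime u v →
      Nat.Coprime s t := fun h h' hc => Nat.Coprime.of_dvd (dvd_of h) (dvd_of h') hc
  have hsq : Squarefree (s1 * s2 * s3 * s4) := by
    have m12 := (Nat.squarefree_mul (cs h1 h2 c12)).2 ⟨q1, q2⟩
    have m123 := (Nat.squarefree_mul ((cs h1 h3 c13).mul_left (cs h2 h3 c23))).2 ⟨m12, q3⟩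
    exact (Nat.squarefree_mul
      (((cs h1 h4 c14).mul_left (cs h2 h4 c24)).mul_left (cs h3 h4 c34))).2 ⟨m123, q4⟩
  have hprod : s1 * s2 * s3 * s4 = d := by
    apply sqfree_unique hsq hd z0 (u := a1 * a2 * a3 * a4)
    rw [← eq]
    calc s1 * s2 * s3 * s4 * (a1 * a2 * a3 * a4) ^ 2
        = (a1 ^ 2 * s1) * (a2 ^ 2 * s2) * (a3 ^ 2 * s3) * (a4 ^ 2 * s4) := by ring
      _ = _ := by rw [h1, h2, h3, h4]
  have hmax : (s1 ≤ s4 ∧ s2 ≤ s4 ∧ s3 ≤ s4) ∨ (s1 ≤ s3 ∧ s2 ≤ s3 ∧ s4 ≤ s3) ∨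
      (s1 ≤ s2 ∧ s3 ≤ s2 ∧ s4 ≤ s2) ∨ (s2 ≤ s1 ∧ s3 ≤ s1 ∧ s4 ≤ s1) := by omega
  rcases hmax with ⟨m1, m2, m3⟩ | ⟨m1, m2, m3⟩ | ⟨m1, m2, m3⟩ | ⟨m1, m2, m3⟩
  · left
    refine ⟨((s1, s2, s3), (a1, a2, a3)), ⟨q1, q2, q3, ?_, ?_⟩, z, z0, ?_⟩
    · exact three_quarter_bound (s := s4) hprod (cube_le m1 m2 m3) hX hY hXY
    · exact sol_mk h1 h2 h3 a1p a2p a3p (by ring) le1 c12 c13 c23 (by simp) (by simp) (by simp)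
        (by simp) (by simp) (by simp)
    · simp only [Fa, Fb]; rw [h1, h2]; exact eq
  · right; left
    refine ⟨((s1, s2, s4), (a1, a2, a4)), ⟨q1, q2, q4, ?_, ?_⟩, z, z0, ?_⟩
    · exact three_quarter_bound (s := s3) (by rw [← hprod]; ring) (cube_le m1 m2 m3) hX hY hXY
    · exact sol_mk h1 h2 h4 a1p a2p a4p (by ring) le3 c12 c14 c24 w2 (by simp) (by simp)
        (by simp) (by simp) v2
    · simp only [Fa, Fb]; rw [h1, h2]; exact eq
  · right; right; left
    refine ⟨((s1, s4, s3), (a1, a4, a3)), ⟨q1, q4, q3, ?_, ?_⟩, z, z0, ?_⟩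
    · exact three_quarter_bound (s := s2) (by rw [← hprod]; ring) (cube_le m1 m3 m2) hX hY hXY
    · exact sol_mk h1 h4 h3 a1p a4p a3p (by ring) le2 c14 c13 c34.symm (by simp) w2 (by simp)
        v2 (by simp) (by simp)
    · simp only [Fa, Fb, Fc]; rw [h1, h4]
      have : (w + 2 * x - w) / 2 = x := by omega
      rw [this]; exact eq
  · right; right; right
    refine ⟨((s2, s3, s4), (a2, a3, a4)), ⟨q2, q3, q4, ?_, ?_⟩, z, z0, ?_⟩
    · exact three_quarter_bound (s := s1) (by rw [← hprod]; ring) (cube_le m1 m2 m3) hX hY hXY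
    · exact sol_mk h2 h3 h4 a2p a3p a4p (by ring) le3 c23 c24 c34 (by simp) (by simp) (by simp)
        (by simp) (by simp) (by simp)
    · simp only [Fa, Fb, Fd]; rw [h2, h3]
      have : w + x - x = w := by omega
      rw [this]; exact eq

theorem bad_count {M X Y R : ℝ} (hY : 1 ≤ Y) (hXY : Y ^ 4 = X ^ 3) (hR0 : 0 < R)
    (hR : R ^ 2 = 2 * M) (D : Finset ℕ)
    (hD : ∀ d ∈ D, Squarefree d ∧ (d : ℝ) ≤ X ∧ ∃ w x z, PtRep d M w x z) :
    (D.card : ℝ) ≤ 8 * (Y + 2 * R * √Y) * (1 + Real.log Y) ^ 6 := by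
  classical
  set D1 := D.filter (Typ 1 1 1 R Y Fa Fb)
  set D2 := D.filter (Typ 1 2 1 R Y Fa Fb)
  set D3 := D.filter (Typ 1 1 2 R Y Fa Fc)
  set D4 := D.filter (Typ 1 1 1 R Y Fd Fa)
  have hsub : D ⊆ D1 ∪ (D2 ∪ (D3 ∪ D4)) := by
    intro d hd
    obtain ⟨h1, h2, w, x, z, h3⟩ := hD d hd
    have := rep_types h3 h1 h2 (by linarith) hXY hR
    simp only [D1, D2, D3, D4, Finset.mem_union, Finset.mem_filter]
    tauto
  have k1 := type_count (by norm_num) (by norm_num) (by norm_num) hR0 hY Fa Fb D1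
    (fun d hd => ⟨(hD d (Finset.mem_filter.1 hd).1).1, (Finset.mem_filter.1 hd).2⟩)
  have k2 := type_count (by norm_num) (by norm_num) (by norm_num) hR0 hY Fa Fb D2
    (fun d hd => ⟨(hD d (Finset.mem_filter.1 hd).1).1, (Finset.mem_filter.1 hd).2⟩)
  have k3 := type_count (by norm_num) (by norm_num) (by norm_num) hR0 hY Fa Fc D3
    (fun d hd => ⟨(hD d (Finset.mem_filter.1 hd).1).1, (Finset.mem_filter.1 hd).2⟩)
  have k4 := type_count (by norm_num) (by norm_num) (by norm_num) hR0 hY Fd Fa D4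
    (fun d hd => ⟨(hD d (Finset.mem_filter.1 hd).1).1, (Finset.mem_filter.1 hd).2⟩)
  have hc : D.card ≤ D1.card + (D2.card + (D3.card + D4.card)) :=
    (Finset.card_le_card hsub).trans ((Finset.card_union_le _ _).trans (Nat.add_le_add_left
      ((Finset.card_union_le _ _).trans (Nat.add_le_add_left (Finset.card_union_le _ _) _)) _))
  have hc' : (D.card : ℝ) ≤ D1.card + (D2.card + (D3.card + D4.card)) := by exact_mod_cast hc
  linarith

open Filter

theorem main_bound (ε : ℝ) (hε : 0 < ε) (hε' : ε < 5 / 4) (X : ℝ) (hX : 1 ≤ X) :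
      (Set.ncard { d : ℤ | 1 ≤ d ∧ (d : ℝ) ≤ X ∧ Squarefree d ∧
        ∃ p q : ℤ, ∃ y : ℚ, Int.gcd p q = 1 ∧ 1 ≤ q ∧ y ≠ 0 ∧
          (d : ℚ) * y ^ 2 = ((p : ℚ) / (q : ℚ)) ^ 3 - (p : ℚ) / (q : ℚ) ∧
          max |(p : ℝ)| (q : ℝ) ≤ (d : ℝ) ^ ((5 : ℝ) / 4 - ε) } : ℝ) ≤
      8 * (X ^ (3 / 4 : ℝ) + 4 * X ^ (1 - ε / 2)) * (1 + Real.log X) ^ 6 := by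
  classical
  have hX0 : 0 < X := by linarith
  set M : ℝ := X ^ ((5 : ℝ) / 4 - ε) with hM
  set Y : ℝ := X ^ (3 / 4 : ℝ) with hY
  set R : ℝ := √2 * X ^ (((5 : ℝ) / 4 - ε) / 2) with hR
  have hY1 : 1 ≤ Y := Real.one_le_rpow hX (by norm_num)
  have hXY : Y ^ 4 = X ^ 3 := by
    rw [hY, ← Real.rpow_natCast, ← Real.rpow_mul hX0.le, ← Real.rpow_natCast]
    norm_num
  have hR0 : 0 < R := by positivity
  have hR2 : R ^ 2 = 2 * M := by
    rw [hR, hM, mul_pow, Real.sq_sqrt (by norm_num), ← Real.rpow_natCast, ← Real.rpow_mul hX0.le]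
    congr 2
    push_cast; ring
  set D : Finset ℕ := (Finset.range (⌊X⌋₊ + 1)).filter
    (fun d => Squarefree d ∧ (d : ℝ) ≤ X ∧ ∃ w x z, PtRep d M w x z) with hD
  have hcount := bad_count (M := M) (X := X) hY1 hXY hR0 hR2 D
    (fun d hd => (Finset.mem_filter.1 hd).2)
  have hsub : { d : ℤ | 1 ≤ d ∧ (d : ℝ) ≤ X ∧ Squarefree d ∧
        ∃ p q : ℤ, ∃ y : ℚ, Int.gcd p q = 1 ∧ 1 ≤ q ∧ y ≠ 0 ∧
          (d : ℚ) * y ^ 2 = ((p : ℚ) / (q : ℚ)) ^ 3 - (p : ℚ) / (q : ℚ) ∧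
          max |(p : ℝ)| (q : ℝ) ≤ (d : ℝ) ^ ((5 : ℝ) / 4 - ε) } ⊆
      ((D.image (fun n : ℕ => (n : ℤ)) : Finset ℤ) : Set ℤ) := by
    rintro d ⟨h1, h2, h3, p, q, y, h4, h5, h6, h7, h8⟩
    have hle : (d : ℝ) ^ ((5 : ℝ) / 4 - ε) ≤ M := by
      apply Real.rpow_le_rpow _ h2 (by linarith)
      exact_mod_cast (by omega : 0 ≤ d)
    have hrep := rep_of_pt h1 h3 h4 h5 h6 h7 (h8.trans hle)
    have hdn : ((d.natAbs : ℕ) : ℤ) = d := Int.natAbs_of_nonneg (by omega)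
    have hdX : ((d.natAbs : ℕ) : ℝ) ≤ X := by
      have : ((d.natAbs : ℕ) : ℝ) = (d : ℝ) := by
        rw [← Int.cast_natCast, hdn]
      rw [this]; exact h2
    rw [Finset.mem_coe, Finset.mem_image]
    refine ⟨d.natAbs, ?_, hdn⟩
    rw [hD, Finset.mem_filter, Finset.mem_range]
    exact ⟨Nat.lt_succ_of_le (Nat.le_floor hdX), Int.squarefree_natAbs.2 h3, hdX, hrep⟩
  have hn1 := Set.ncard_le_ncard hsub (Finset.finite_toSet _)
  rw [Set.ncard_coe_finset] at hn1
  have hn2 := hn1.trans Finset.card_image_le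
  have hn3 : (Set.ncard { d : ℤ | 1 ≤ d ∧ (d : ℝ) ≤ X ∧ Squarefree d ∧
        ∃ p q : ℤ, ∃ y : ℚ, Int.gcd p q = 1 ∧ 1 ≤ q ∧ y ≠ 0 ∧
          (d : ℚ) * y ^ 2 = ((p : ℚ) / (q : ℚ)) ^ 3 - (p : ℚ) / (q : ℚ) ∧
          max |(p : ℝ)| (q : ℝ) ≤ (d : ℝ) ^ ((5 : ℝ) / 4 - ε) } : ℝ) ≤ D.card := by
    exact_mod_cast hn2
  refine hn3.trans (hcount.trans ?_)
  have hsY : √Y = X ^ (3 / 8 : ℝ) := by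
    rw [hY, Real.sqrt_eq_rpow, ← Real.rpow_mul hX0.le]; norm_num
  have hRY : 2 * R * √Y ≤ 4 * X ^ (1 - ε / 2) := by
    rw [hsY, hR]
    have e1 : X ^ (1 - ε / 2) = X ^ (((5 : ℝ) / 4 - ε) / 2) * X ^ (3 / 8 : ℝ) := by
      rw [← Real.rpow_add hX0]; congr 1; ring
    rw [e1]
    have : √2 ≤ 2 := by
      rw [Real.sqrt_le_left (by norm_num)]; norm_num
    have hp : 0 < X ^ (((5 : ℝ) / 4 - ε) / 2) * X ^ (3 / 8 : ℝ) := by positivity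
    nlinarith
  have hlog : Real.log Y ≤ Real.log X := by
    rw [hY, Real.log_rpow hX0]
    have := Real.log_nonneg hX
    linarith
  have hlogY : 0 ≤ Real.log Y := Real.log_nonneg hY1
  have hlogX : 0 ≤ Real.log X := Real.log_nonneg hX
  have hp6 : (1 + Real.log Y) ^ 6 ≤ (1 + Real.log X) ^ 6 :=
    pow_le_pow_left₀ (by linarith) (by linarith) 6
  have : 0 < X ^ (1 - ε / 2) := by positivity
  apply mul_le_mul _ hp6 (by positivity) (by positivity)
  linarith

/-- Naive-height form of Theorem 2: for almost every squarefree `d`, every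
rational point with nonzero y-coordinate on `d y² = x³ - x` has naive
x-height exceeding `d^{5/4-ε}`. -/
theorem stmt_11 (ε : ℝ) (hε : 0 < ε) (hε' : ε < 5 / 4) :
    Tendsto (fun X : ℝ =>
      (Set.ncard { d : ℤ | 1 ≤ d ∧ (d : ℝ) ≤ X ∧ Squarefree d ∧
        ∃ p q : ℤ, ∃ y : ℚ, Int.gcd p q = 1 ∧ 1 ≤ q ∧ y ≠ 0 ∧
          (d : ℚ) * y ^ 2 = ((p : ℚ) / (q : ℚ)) ^ 3 - (p : ℚ) / (q : ℚ) ∧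
          max |(p : ℝ)| (q : ℝ) ≤ (d : ℝ) ^ ((5 : ℝ) / 4 - ε) } : ℝ) / X)
      atTop (nhds 0) := by
  set c : ℝ := min (1 / 4) (ε / 2) with hc
  have hc0 : 0 < c := by rw [hc]; positivity
  have hc1 : c ≤ 1 / 4 := min_le_left _ _
  have hc2 : c ≤ ε / 2 := min_le_right _ _
  set η : ℝ := c / 12 with hη
  have hη0 : 0 < η := by positivity
  set C : ℝ := 40 * (1 + 1 / η) ^ 6 with hC
  have hlim : Tendsto (fun X : ℝ => C * X ^ (-(c / 2))) atTop (nhds 0) := by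
    have := (tendsto_rpow_neg_atTop (by positivity : 0 < c / 2)).const_mul C
    simpa using this
  refine squeeze_zero' ?_ ?_ hlim
  · filter_upwards [eventually_ge_atTop 1] with X hX
    positivity
  · filter_upwards [eventually_ge_atTop 1] with X hX
    have hX0 : 0 < X := by linarith
    rw [div_le_iff₀ hX0]
    refine (main_bound ε hε hε' X hX).trans ?_
    have b1 : X ^ (3 / 4 : ℝ) ≤ X ^ (1 - c) := Real.rpow_le_rpow_of_exponent_le hX (by linarith)
    have b2 : X ^ (1 - ε / 2) ≤ X ^ (1 - c) := Real.rpow_le_rpow_of_exponent_le hX (by linarith)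
    have b3 : 1 + Real.log X ≤ (1 + 1 / η) * X ^ η := by
      have h1 := Real.log_le_rpow_div hX0.le hη0
      have h2 : 1 ≤ X ^ η := Real.one_le_rpow hX hη0.le
      have : (1 + 1 / η) * X ^ η = X ^ η + X ^ η / η := by ring
      rw [this]; linarith
    have hlogX : 0 ≤ Real.log X := Real.log_nonneg hX
    have b4 : (1 + Real.log X) ^ 6 ≤ (1 + 1 / η) ^ 6 * X ^ (c / 2) := by
      refine (pow_le_pow_left₀ (by linarith) b3 6).trans (le_of_eq ?_)
      rw [mul_pow, ← Real.rpow_natCast (X ^ η), ← Real.rpow_mul hX0.le]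
      congr 2
      rw [hη]; push_cast; ring
    have hp : 0 < X ^ (1 - c) := by positivity
    calc 8 * (X ^ (3 / 4 : ℝ) + 4 * X ^ (1 - ε / 2)) * (1 + Real.log X) ^ 6
        ≤ (40 * X ^ (1 - c)) * ((1 + 1 / η) ^ 6 * X ^ (c / 2)) := by
          apply mul_le_mul _ b4 (by positivity) (by positivity)
          linarith
      _ = C * (X ^ (1 - c) * X ^ (c / 2)) := by rw [hC]; ring
      _ = C * (X ^ (-(c / 2)) * X) := by
          rw [← Real.rpow_add hX0]
          have : X ^ (-(c / 2)) * X = X ^ (-(c / 2) + 1) := by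
            rw [Real.rpow_add hX0, Real.rpow_one]
          rw [this]
          congr 2; ring
      _ = _ := by ring
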